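/- arXiv:1909.00059 — 8 statements merged into one kernel-verified Lean document; each statement's English description precedes it below -/
import Mathlib

section
/- Under the stated hypotheses, with every digraph G(k) strongly connected and n' ≥ n−1 a fixed integer: for any u ≥ 0, if m(u·n') < M(u·n'), then M((u+1)·n') < M(u·n') and m((u+1)·n') > m(u·n'). -/
open Filter Topology

open Finset in
/-- One step of a nonnegative recursion over a strongly connected digraph with self-loops preserves
nonnegativity and strictly enlarges the support until it is everything. -/
theorem nonneg_and_support_grows {ι : Type*} [Fintype ι] {E : ι → ι → Prop}
    (hself : ∀ i, E i i)
    (hconn : ∀ i j, i ≠ j →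
      ∃ (s : ℕ) (c : ℕ → ι), c 0 = i ∧ c s = j ∧ ∀ l < s, E (c (l + 1)) (c l))
    {p : ι → ι → ℝ} (hp_nonneg : ∀ i j, 0 ≤ p i j) (hp_pos : ∀ i j, E i j → 0 < p i j)
    {z z' : ι → ℝ} (hz : ∀ i, z' i = ∑ j, p i j * z j) (h0 : ∀ i, 0 ≤ z i)
    (hne : ∃ i, 0 < z i) :
    (∀ i, 0 ≤ z' i) ∧ (∀ i, 0 < z i → 0 < z' i) ∧
      ((∃ j, ¬ 0 < z j) → ∃ j, ¬ 0 < z j ∧ 0 < z' j) := by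
  have key : ∀ i j, E i j → 0 < z j → 0 < z' i := by
    intro i j hij hj
    rw [hz]
    exact sum_pos' (fun l _ => mul_nonneg (hp_nonneg i l) (h0 l))
      ⟨j, mem_univ j, mul_pos (hp_pos i j hij) hj⟩
  refine ⟨fun i => ?_, fun i => key i i (hself i), ?_⟩
  · rw [hz]
    exact sum_nonneg fun l _ => mul_nonneg (hp_nonneg i l) (h0 l)
  · rintro ⟨j, hj⟩
    obtain ⟨i, hi⟩ := hne
    obtain ⟨s, c, rfl, rfl, hc⟩ := hconn i j (by rintro rfl; exact hj hi)
    by_contra! hno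
    have hall : ∀ l ≤ s, 0 < z (c l) := by
      intro l
      induction l with
      | zero => exact fun _ => hi
      | succ l ih =>
        intro hl
        by_contra hneg
        have h1 := key _ _ (hc l (by omega)) (ih (by omega))
        exact absurd (hno (c (l + 1)) (not_lt.mp hneg)) (not_le.mpr h1)
    exact hj (hall s le_rfl)

open Finset in
/-- A nonzero nonnegative vector becomes positive after at least `card ι - 1` steps. -/
theorem pos_of_card_sub_one_le {ι : Type*} [Fintype ι] {E : ℕ → ι → ι → Prop}
    (hself : ∀ k i, E k i i)
    (hconn : ∀ k i j, i ≠ j →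
      ∃ (s : ℕ) (c : ℕ → ι), c 0 = i ∧ c s = j ∧ ∀ l < s, E k (c (l + 1)) (c l))
    {p : ℕ → ι → ι → ℝ} (hp_nonneg : ∀ k i j, 0 ≤ p k i j)
    (hp_pos : ∀ k i j, E k i j → 0 < p k i j)
    {z : ℕ → ι → ℝ} (hz : ∀ k i, z (k + 1) i = ∑ j, p k i j * z k j)
    {k : ℕ} (h0 : ∀ i, 0 ≤ z k i) (hne : ∃ i, 0 < z k i)
    {t : ℕ} (ht : Fintype.card ι - 1 ≤ t) (i : ι) : 0 < z (k + t) i := by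
  classical
  have main : ∀ t, (∀ i, 0 ≤ z (k + t) i) ∧ (∃ i, 0 < z (k + t) i) ∧
      ((∀ i, 0 < z (k + t) i) ∨ t + 1 ≤ #{i | 0 < z (k + t) i}) := by
    intro t
    induction t with
    | zero =>
      refine ⟨h0, hne, Or.inr ?_⟩
      obtain ⟨i, hi⟩ := hne
      exact card_pos.mpr ⟨i, by simpa using hi⟩
    | succ t ih =>
      obtain ⟨hnn, hex, hsupp⟩ := ih
      obtain ⟨hnn', hmono, hgrow⟩ := nonneg_and_support_grows (hself (k + t)) (hconn (k + t))
        (hp_nonneg (k + t)) (hp_pos (k + t)) (hz (k + t)) hnn hex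
      refine ⟨hnn', hex.imp hmono, ?_⟩
      by_cases hfull : ∀ i, 0 < z (k + t) i
      · exact Or.inl fun i => hmono i (hfull i)
      · obtain ⟨j, hj, hj'⟩ := hgrow (not_forall.mp hfull)
        refine Or.inr (Nat.succ_le_of_lt ((hsupp.resolve_left hfull).trans_lt (card_lt_card ?_)))
        refine (ssubset_iff_of_subset fun i => ?_).mpr ⟨j, ?_, ?_⟩
        · simpa [← add_assoc] using hmono i
        · simpa [← add_assoc] using hj'
        · simpa using hj
  obtain ⟨-, -, hall | hcard⟩ := main t
  · exact hall i
  · have huniv : ({i | 0 < z (k + t) i} : Finset ι) = univ :=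
      eq_univ_of_card _ (le_antisymm (card_le_univ _) (by omega))
    simpa using huniv.ge (mem_univ i)

theorem stmt_1 (n : ℕ) (hn : 1 ≤ n)
    (E : ℕ → Fin n → Fin n → Prop)
    (hself : ∀ (k : ℕ) (i : Fin n), E k i i)
    (hconn : ∀ (k : ℕ) (i j : Fin n), i ≠ j →
      ∃ (s : ℕ) (c : ℕ → Fin n), c 0 = i ∧ c s = j ∧ ∀ l < s, E k (c (l + 1)) (c l))
    (p : ℕ → Fin n → Fin n → ℝ)
    (hp_nonneg : ∀ (k : ℕ) (i j : Fin n), 0 ≤ p k i j)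
    (hp_pos : ∀ (k : ℕ) (i j : Fin n), 0 < p k i j ↔ E k i j)
    (hp_col : ∀ (k : ℕ) (j : Fin n), ∑ i, p k i j = 1)
    (x y : ℕ → Fin n → ℝ)
    (hy0 : ∀ i : Fin n, y 0 i = 1)
    (hx : ∀ (k : ℕ) (i : Fin n), x (k + 1) i = ∑ j, p k i j * x k j)
    (hy : ∀ (k : ℕ) (i : Fin n), y (k + 1) i = ∑ j, p k i j * y k j)
    (M m : ℕ → ℝ)
    (hM : ∀ k : ℕ, IsGreatest (Set.range fun i => x k i / y k i) (M k))
    (hm : ∀ k : ℕ, IsLeast (Set.range fun i => x k i / y k i) (m k))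
    (n' : ℕ) (hn' : n - 1 ≤ n')
    :
    ∀ u : ℕ, m (u * n') < M (u * n') →
      M ((u + 1) * n') < M (u * n') ∧ m ((u + 1) * n') > m (u * n') := by
  intro u hlt
  have hy_pos : ∀ k i, 0 < y k i := by
    intro k
    induction k with
    | zero => intro i; rw [hy0]; exact one_pos
    | succ k ih =>
      intro i
      rw [hy]
      exact Finset.sum_pos' (fun j _ => mul_nonneg (hp_nonneg k i j) (ih j).le)
        ⟨i, Finset.mem_univ i, mul_pos ((hp_pos k i i).mpr (hself k i)) (ih i)⟩
  have hcard : Fintype.card (Fin n) - 1 ≤ n' := by simpa using hn'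
  obtain ⟨iM, hiM⟩ := (hM (u * n')).1
  obtain ⟨im, him⟩ := (hm (u * n')).1
  have hle : ∀ i, x (u * n') i ≤ M (u * n') * y (u * n') i := fun i =>
    (div_le_iff₀ (hy_pos _ i)).mp ((hM (u * n')).2 ⟨i, rfl⟩)
  have hge : ∀ i, m (u * n') * y (u * n') i ≤ x (u * n') i := fun i =>
    (le_div_iff₀ (hy_pos _ i)).mp ((hm (u * n')).2 ⟨i, rfl⟩)
  have hup := pos_of_card_sub_one_le (z := fun k i => M (u * n') * y k i - x k i) hself hconn
    hp_nonneg (fun k i j => (hp_pos k i j).mpr)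
    (fun k i => by
      simp only [hx, hy, Finset.mul_sum, ← Finset.sum_sub_distrib]
      exact Finset.sum_congr rfl fun j _ => by ring)
    (k := u * n') (fun i => sub_nonneg.mpr (hle i))
    ⟨im, sub_pos.mpr ((div_lt_iff₀ (hy_pos _ im)).mp (him.trans_lt hlt))⟩ hcard
  have hlow := pos_of_card_sub_one_le (z := fun k i => x k i - m (u * n') * y k i) hself hconn
    hp_nonneg (fun k i j => (hp_pos k i j).mpr)
    (fun k i => by
      simp only [hx, hy, Finset.mul_sum, ← Finset.sum_sub_distrib]
      exact Finset.sum_congr rfl fun j _ => by ring)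
    (k := u * n') (fun i => sub_nonneg.mpr (hge i))
    ⟨iM, sub_pos.mpr ((lt_div_iff₀ (hy_pos _ iM)).mp (hlt.trans_eq hiM.symm))⟩ hcard
  rw [add_one_mul]
  obtain ⟨a, ha⟩ := (hM (u * n' + n')).1
  obtain ⟨b, hb⟩ := (hm (u * n' + n')).1
  rw [← ha, ← hb]
  exact ⟨(div_lt_iff₀ (hy_pos _ a)).mpr (sub_pos.mp (hup a)),
    (lt_div_iff₀ (hy_pos _ b)).mpr (sub_pos.mp (hlow b))⟩
end

section
/- Under the stated hypotheses with every digraph G(k) strongly connected: if at some time k one has M(k) − m(k) < ρ for a given ρ > 0, then for every node i and every time k' ≥ k, |x_i(k')/y_i(k') − (Σ_{j∈V} x_j(0))/n| < ρ; that is, once the max–min gap is below ρ, every subsequent ratio is within ρ of the consensus value. -/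
open Filter Topology

/-- A column-stochastic matrix preserves the sum of the entries of a vector. -/
theorem sum_sum_mul_of_col_stochastic {ι : Type*} [Fintype ι] {p : ι → ι → ℝ}
    (hp : ∀ j, ∑ i, p i j = 1) (v : ι → ℝ) : ∑ i, ∑ j, p i j * v j = ∑ j, v j := by
  rw [Finset.sum_comm]
  simp_rw [← Finset.sum_mul, hp, one_mul]

/-- An entrywise bound `a * u ≤ v` is inherited by the images under a nonnegative matrix. -/
theorem mul_sum_le_sum_mul_of_nonneg {ι : Type*} [Fintype ι] {p : ι → ι → ℝ}
    (hp : ∀ i j, 0 ≤ p i j) {u v : ι → ℝ} {a : ℝ} (h : ∀ j, a * u j ≤ v j) (i : ι) :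
    a * ∑ j, p i j * u j ≤ ∑ j, p i j * v j := by
  rw [Finset.mul_sum]
  refine Finset.sum_le_sum fun j _ => ?_
  rw [mul_left_comm]
  exact mul_le_mul_of_nonneg_left (h j) (hp i j)

/-- An entrywise bound `v ≤ a * u` is inherited by the images under a nonnegative matrix. -/
theorem sum_mul_le_mul_sum_of_nonneg {ι : Type*} [Fintype ι] {p : ι → ι → ℝ}
    (hp : ∀ i j, 0 ≤ p i j) {u v : ι → ℝ} {a : ℝ} (h : ∀ j, v j ≤ a * u j) (i : ι) :
    ∑ j, p i j * v j ≤ a * ∑ j, p i j * u j := by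
  rw [Finset.mul_sum]
  refine Finset.sum_le_sum fun j _ => ?_
  rw [mul_left_comm a]
  exact mul_le_mul_of_nonneg_left (h j) (hp i j)

theorem stmt_4 (n : ℕ) (hn : 1 ≤ n)
    (E : ℕ → Fin n → Fin n → Prop)
    (hself : ∀ (k : ℕ) (i : Fin n), E k i i)
    (hconn : ∀ (k : ℕ) (i j : Fin n), i ≠ j →
      ∃ (s : ℕ) (c : ℕ → Fin n), c 0 = i ∧ c s = j ∧ ∀ l < s, E k (c (l + 1)) (c l))
    (p : ℕ → Fin n → Fin n → ℝ)
    (hp_nonneg : ∀ (k : ℕ) (i j : Fin n), 0 ≤ p k i j)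
    (hp_pos : ∀ (k : ℕ) (i j : Fin n), 0 < p k i j ↔ E k i j)
    (hp_col : ∀ (k : ℕ) (j : Fin n), ∑ i, p k i j = 1)
    (x y : ℕ → Fin n → ℝ)
    (hy0 : ∀ i : Fin n, y 0 i = 1)
    (hx : ∀ (k : ℕ) (i : Fin n), x (k + 1) i = ∑ j, p k i j * x k j)
    (hy : ∀ (k : ℕ) (i : Fin n), y (k + 1) i = ∑ j, p k i j * y k j)
    (M m : ℕ → ℝ)
    (hM : ∀ k : ℕ, IsGreatest (Set.range fun i => x k i / y k i) (M k))
    (hm : ∀ k : ℕ, IsLeast (Set.range fun i => x k i / y k i) (m k))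
    :
    ∀ (ρ : ℝ), 0 < ρ → ∀ k : ℕ, M k - m k < ρ →
      ∀ (i : Fin n) (k' : ℕ), k ≤ k' →
        |x k' i / y k' i - (∑ j, x 0 j) / (n : ℝ)| < ρ := by
  intro ρ _ k hρ i k' hk
  have hy_pos : ∀ k i, 0 < y k i := by
    intro k
    induction k with
    | zero => simp [hy0]
    | succ k ih =>
      intro i
      rw [hy]
      exact Finset.sum_pos' (fun j _ => mul_nonneg (hp_nonneg k i j) (ih j).le)
        ⟨i, Finset.mem_univ i, mul_pos ((hp_pos k i i).2 (hself k i)) (ih i)⟩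
  have hx_sum : ∀ k, ∑ j, x k j = ∑ j, x 0 j := by
    intro k
    induction k with
    | zero => rfl
    | succ k ih => simp_rw [hx, sum_sum_mul_of_col_stochastic (hp_col k), ih]
  have hy_sum : ∀ k, ∑ j, y k j = n := by
    intro k
    induction k with
    | zero => simp [hy0]
    | succ k ih => simp_rw [hy, sum_sum_mul_of_col_stochastic (hp_col k), ih]
  have hlower : ∀ j, m k * y k j ≤ x k j := fun j =>
    (le_div_iff₀ (hy_pos k j)).1 ((hm k).2 ⟨j, rfl⟩)
  have hupper : ∀ j, x k j ≤ M k * y k j := fun j =>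
    (div_le_iff₀ (hy_pos k j)).1 ((hM k).2 ⟨j, rfl⟩)
  have hbounds : ∀ j, m k * y k' j ≤ x k' j ∧ x k' j ≤ M k * y k' j := by
    induction k', hk using Nat.le_induction with
    | base => exact fun j => ⟨hlower j, hupper j⟩
    | succ l _ ih =>
      intro j
      rw [hx, hy]
      exact ⟨mul_sum_le_sum_mul_of_nonneg (hp_nonneg l) (fun j => (ih j).1) j,
        sum_mul_le_mul_sum_of_nonneg (hp_nonneg l) (fun j => (ih j).2) j⟩
  have hn_pos : (0 : ℝ) < n := by exact_mod_cast hn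
  have hmean_lower : m k ≤ (∑ j, x 0 j) / n := by
    rw [le_div_iff₀ hn_pos, ← hy_sum k, ← hx_sum k, Finset.mul_sum]
    exact Finset.sum_le_sum fun j _ => hlower j
  have hmean_upper : (∑ j, x 0 j) / n ≤ M k := by
    rw [div_le_iff₀ hn_pos, ← hy_sum k, ← hx_sum k, Finset.mul_sum]
    exact Finset.sum_le_sum fun j _ => hupper j
  have hratio_lower := (le_div_iff₀ (hy_pos k' i)).2 (hbounds i).1
  have hratio_upper := (div_le_iff₀ (hy_pos k' i)).2 (hbounds i).2
  rw [abs_lt]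
  constructor <;> linarith
end

section
/- (Maximum-consensus protocol converges in finite time.) Assume every digraph G(k) is strongly connected and has a self-loop at every node. Fix a start time k₀ and arbitrary initial values z_i(k₀) ∈ ℝ, and run the MXP updates for k ≥ k₀. Then for every time k ≥ k₀ + (n − 1) and every node i ∈ V, z_i(k) = max_{j∈V} z_j(k₀). -/
open Filter Topology

/-- A sequence that starts in `S` and is outside `S` at time `s` leaves `S` at some step
before `s`. -/
theorem exists_exit_step {α : Type*} (S : Set α) (c : ℕ → α) (s : ℕ)
    (h0 : c 0 ∈ S) (hs : c s ∉ S) : ∃ l < s, c l ∈ S ∧ c (l + 1) ∉ S := by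
  by_contra! h
  have key : ∀ l ≤ s, c l ∈ S := by
    intro l
    induction l with
    | zero => exact fun _ => h0
    | succ l ih => exact fun hl => h l hl (ih (by omega))
  exact hs (key s le_rfl)

/-- While an upper bound `M` of the states is attained somewhere, it stays an upper bound, and
the set of nodes attaining it gains at least one node per step until it is everything. -/
theorem le_and_min_le_card_maximizers {V : Type*} [Fintype V]
    (E : ℕ → V → V → Prop) (hself : ∀ k i, E k i i)
    (hconn : ∀ (k : ℕ) (i j : V), i ≠ j →
      ∃ (s : ℕ) (c : ℕ → V), c 0 = i ∧ c s = j ∧ ∀ l < s, E k (c (l + 1)) (c l))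
    (k₀ : ℕ) (z : ℕ → V → ℝ)
    (hz : ∀ k : ℕ, k₀ ≤ k → ∀ i : V,
      IsGreatest {v : ℝ | ∃ j : V, E k i j ∧ v = z k j} (z (k + 1) i))
    (M : ℝ) (hM : ∀ i, z k₀ i ≤ M) (m : V) (hm : z k₀ m = M) (t : ℕ) :
    (∀ i, z (k₀ + t) i ≤ M) ∧
      min (Fintype.card V) (t + 1) ≤ (Finset.univ.filter fun i => z (k₀ + t) i = M).card := by
  induction t with
  | zero =>
    refine ⟨hM, (min_le_right _ _).trans ?_⟩
    exact Finset.card_pos.mpr ⟨m, by simp [hm]⟩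
  | succ t ih =>
    obtain ⟨hle, hcard⟩ := ih
    have hz' := hz (k₀ + t) (Nat.le_add_right _ _)
    rw [← Nat.add_assoc k₀ t 1]
    have hle' : ∀ i, z (k₀ + t + 1) i ≤ M := by
      intro i
      obtain ⟨j, -, hj⟩ := (hz' i).1
      exact hj ▸ hle j
    have hspread : ∀ i j, E (k₀ + t) i j → z (k₀ + t) j = M → z (k₀ + t + 1) i = M :=
      fun i j hij hj => le_antisymm (hle' i) (hj ▸ (hz' i).2 ⟨j, hij, rfl⟩)
    refine ⟨hle', ?_⟩
    have hsub : (Finset.univ.filter fun i => z (k₀ + t) i = M) ⊆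
        Finset.univ.filter fun i => z (k₀ + t + 1) i = M := by
      intro i hi
      simp only [Finset.mem_filter, Finset.mem_univ, true_and] at hi ⊢
      exact hspread i i (hself _ i) hi
    by_cases hall : ∀ i, z (k₀ + t) i = M
    · rw [Finset.filter_true_of_mem fun i _ => hspread i i (hself _ i) (hall i)]
      exact min_le_left _ _
    · push Not at hall
      obtain ⟨j, hj⟩ := hall
      have hpos : 0 < (Finset.univ.filter fun i => z (k₀ + t) i = M).card :=
        lt_of_lt_of_le (lt_min (Fintype.card_pos_iff.mpr ⟨m⟩) t.succ_pos) hcard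
      obtain ⟨a, ha⟩ := Finset.card_pos.mp hpos
      replace ha : z (k₀ + t) a = M := by simpa using ha
      obtain ⟨s, c, h0, hs, hE⟩ := hconn (k₀ + t) a j (by rintro rfl; exact hj ha)
      obtain ⟨l, hl, hin, hout⟩ := exists_exit_step {i | z (k₀ + t) i = M} c s
        (by simpa [h0] using ha) (by simpa [hs] using hj)
      have hlt := Finset.card_lt_card (Finset.ssubset_iff_subset_ne.mpr ⟨hsub, fun heq => hout (by
        have hmem : c (l + 1) ∈ Finset.univ.filter fun i => z (k₀ + t + 1) i = M := by
          simpa using hspread _ _ (hE l hl) hin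
        rw [← heq] at hmem
        simpa using hmem)⟩)
      omega

theorem stmt_5 (n : ℕ) (hn : 1 ≤ n)
    (E : ℕ → Fin n → Fin n → Prop)
    (hself : ∀ (k : ℕ) (i : Fin n), E k i i)
    (hconn : ∀ (k : ℕ) (i j : Fin n), i ≠ j →
      ∃ (s : ℕ) (c : ℕ → Fin n), c 0 = i ∧ c s = j ∧ ∀ l < s, E k (c (l + 1)) (c l))
    (k₀ : ℕ) (z : ℕ → Fin n → ℝ)
    (hz : ∀ k : ℕ, k₀ ≤ k → ∀ i : Fin n,
      IsGreatest {v : ℝ | ∃ j : Fin n, E k i j ∧ v = z k j} (z (k + 1) i))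
    :
    ∀ k : ℕ, k₀ + (n - 1) ≤ k → ∀ i : Fin n,
      IsGreatest (Set.range (z k₀)) (z k i) := by
  intro k hk i
  obtain ⟨t, rfl⟩ := Nat.exists_eq_add_of_le (le_of_add_le_left hk)
  have : Nonempty (Fin n) := ⟨i⟩
  obtain ⟨m, hm⟩ := Finite.exists_max (z k₀)
  obtain ⟨-, hcard⟩ := le_and_min_le_card_maximizers E hself hconn k₀ z hz (z k₀ m) hm m rfl t
  rw [Fintype.card_fin, min_eq_left (by omega)] at hcard
  have huniv := Finset.eq_univ_of_card _
    (le_antisymm (Finset.card_le_univ _) (by rwa [Fintype.card_fin]))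
  have hi : z (k₀ + t) i = z k₀ m := by simpa using Finset.eq_univ_iff_forall.mp huniv i
  rw [hi]
  exact ⟨⟨m, rfl⟩, by rintro _ ⟨j, rfl⟩; exact hm j⟩
end

section
/- (Minimum-consensus protocol converges in finite time.) Assume every digraph G(k) is strongly connected and has a self-loop at every node. Fix a start time k₀ and arbitrary initial values w_i(k₀) ∈ ℝ, and run the MNP updates for k ≥ k₀. Then for every time k ≥ k₀ + (n − 1) and every node i ∈ V, w_i(k) = min_{j∈V} w_j(k₀). -/
open Filter Topology

/-- A sequence that starts inside `S` and is outside `S` at time `s` leaves `S` at some step. -/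
theorem exists_mem_succ_notMem {α : Type*} {S : Set α} {c : ℕ → α} {s : ℕ}
    (h0 : c 0 ∈ S) (hs : c s ∉ S) : ∃ l < s, c l ∈ S ∧ c (l + 1) ∉ S := by
  by_contra! h
  have key : ∀ l ≤ s, c l ∈ S := by
    intro l
    induction l with
    | zero => exact fun _ => h0
    | succ l ih => exact fun hl => h l hl (ih (Nat.le_of_succ_le hl))
  exact hs (key s le_rfl)

theorem stmt_6 (n : ℕ) (hn : 1 ≤ n)
    (E : ℕ → Fin n → Fin n → Prop)
    (hself : ∀ (k : ℕ) (i : Fin n), E k i i)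
    (hconn : ∀ (k : ℕ) (i j : Fin n), i ≠ j →
      ∃ (s : ℕ) (c : ℕ → Fin n), c 0 = i ∧ c s = j ∧ ∀ l < s, E k (c (l + 1)) (c l))
    (k₀ : ℕ) (w : ℕ → Fin n → ℝ)
    (hw : ∀ k : ℕ, k₀ ≤ k → ∀ i : Fin n,
      IsLeast {v : ℝ | ∃ j : Fin n, E k i j ∧ v = w k j} (w (k + 1) i))
    :
    ∀ k : ℕ, k₀ + (n - 1) ≤ k → ∀ i : Fin n,
      IsLeast (Set.range (w k₀)) (w k i) := by
  have : Nonempty (Fin n) := ⟨⟨0, hn⟩⟩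
  obtain ⟨j₀, hj₀⟩ := Finite.exists_min (w k₀)
  have hlow : ∀ t i, w k₀ j₀ ≤ w (k₀ + t) i := by
    intro t
    induction t with
    | zero => exact hj₀
    | succ t ih =>
      intro i
      obtain ⟨j, -, hj⟩ := (hw (k₀ + t) (Nat.le_add_right _ _) i).1
      exact (ih j).trans_eq hj.symm
  have hprop : ∀ t i j, E (k₀ + t) i j → w (k₀ + t) j = w k₀ j₀ →
      w (k₀ + (t + 1)) i = w k₀ j₀ := fun t i j hij hj =>
    le_antisymm (((hw (k₀ + t) (Nat.le_add_right _ _) i).2 ⟨j, hij, rfl⟩).trans_eq hj)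
      (hlow (t + 1) i)
  let S : ℕ → Finset (Fin n) := fun t => Finset.univ.filter fun i => w (k₀ + t) i = w k₀ j₀
  have hS : ∀ t i, i ∈ S t ↔ w (k₀ + t) i = w k₀ j₀ := fun t i => by simp [S]
  have hsub : ∀ t, S t ⊆ S (t + 1) := fun t i hi =>
    (hS _ _).2 (hprop t i i (hself _ i) ((hS _ _).1 hi))
  have hcard : ∀ t, min n (t + 1) ≤ (S t).card := by
    intro t
    induction t with
    | zero =>
      have : 0 < (S 0).card := Finset.card_pos.2 ⟨j₀, (hS _ _).2 rfl⟩
      omega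
    | succ t ih =>
      by_cases hu : S t = Finset.univ
      · have := Finset.card_le_card (hsub t)
        rw [hu, Finset.card_univ, Fintype.card_fin] at this
        omega
      · obtain ⟨i, hi⟩ : (S t).Nonempty := Finset.card_pos.1 (by omega)
        obtain ⟨j, hj⟩ : ∃ j, j ∉ S t := by
          by_contra! h
          exact hu (Finset.eq_univ_iff_forall.2 h)
        obtain ⟨s, c, rfl, rfl, hc⟩ := hconn (k₀ + t) i j (fun h => hj (h ▸ hi))
        obtain ⟨l, hl, hin, hout⟩ :=
          exists_mem_succ_notMem (S := (S t : Set (Fin n))) hi hj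
        have hnew : c (l + 1) ∈ S (t + 1) :=
          (hS _ _).2 (hprop t _ _ (hc l hl) ((hS _ _).1 hin))
        have := Finset.card_lt_card ((Finset.ssubset_iff_of_subset (hsub t)).2 ⟨_, hnew, hout⟩)
        omega
  intro k hk i
  obtain ⟨t, rfl⟩ := Nat.exists_eq_add_of_le ((Nat.le_add_right _ _).trans hk)
  have huniv : S t = Finset.univ := by
    refine (Finset.card_eq_iff_eq_univ _).1 (le_antisymm (Finset.card_le_univ _) ?_)
    have := hcard t
    rw [Fintype.card_fin]
    omega
  have hi : w (k₀ + t) i = w k₀ j₀ := (hS t i).1 (huniv ▸ Finset.mem_univ i)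
  rw [hi]
  exact ⟨⟨j₀, rfl⟩, by rintro _ ⟨j, rfl⟩; exact hj₀ j⟩
end

section
/- Under the stated hypotheses with every digraph G(k) strongly connected, let n' ≥ n − 1 be an integer and let k be a time at which m(k) < M(k). Then for all times k' ≥ k + n' and for every node i ∈ V, the strict inequalities m(k) < x_i(k')/y_i(k') < M(k) hold. -/
open Filter Topology

/-- If a sequence of indices starts where `P` holds and ends where it fails, then `P` is lost
at some step. -/
theorem exists_step_of_holds_of_not_holds {P : ℕ → Prop} {s : ℕ} (h0 : P 0) (hs : ¬ P s) :
    ∃ l < s, P l ∧ ¬ P (l + 1) := by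
  by_contra! h
  have key : ∀ l ≤ s, P l := by
    intro l
    induction l with
    | zero => exact fun _ => h0
    | succ l ih => exact fun hl => h l hl (ih (Nat.le_of_succ_le hl))
  exact hs (key s le_rfl)

/-- A nonnegative linear recursion keeps nonnegative vectors nonnegative. -/
theorem nonneg_of_nonneg_recursion {V : Type*} [Fintype V] {p : ℕ → V → V → ℝ}
    (hp : ∀ k i j, 0 ≤ p k i j) {z : ℕ → V → ℝ}
    (hz : ∀ k i, z (k + 1) i = ∑ j, p k i j * z k j) {k : ℕ} (h0 : ∀ i, 0 ≤ z k i) (t : ℕ) :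
    ∀ i, 0 ≤ z (k + t) i := by
  induction t with
  | zero => exact h0
  | succ t ih =>
    intro i
    rw [← add_assoc, hz]
    exact Finset.sum_nonneg fun j _ => mul_nonneg (hp _ _ _) (ih j)

/-- In a nonnegative linear recursion, positivity propagates along positive weights. -/
theorem pos_succ_of_pos_of_weight_pos {V : Type*} [Fintype V] {p : ℕ → V → V → ℝ}
    (hp : ∀ k i j, 0 ≤ p k i j) {z : ℕ → V → ℝ}
    (hz : ∀ k i, z (k + 1) i = ∑ j, p k i j * z k j) {k : ℕ} (h0 : ∀ i, 0 ≤ z k i)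
    {i j : V} (hpij : 0 < p k i j) (hj : 0 < z k j) : 0 < z (k + 1) i := by
  rw [hz]
  exact Finset.sum_pos' (fun l _ => mul_nonneg (hp _ _ _) (h0 l))
    ⟨j, Finset.mem_univ j, mul_pos hpij hj⟩

/-- Along strongly connected digraphs with self-loops, the support of a nonzero nonnegative
vector grows by at least one node per step until it is everything. -/
theorem min_card_le_card_support {V : Type*} [Fintype V] {p : ℕ → V → V → ℝ}
    (hp : ∀ k i j, 0 ≤ p k i j) (hself : ∀ k i, 0 < p k i i)
    (hconn : ∀ (k : ℕ) (i j : V), i ≠ j →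
      ∃ (s : ℕ) (c : ℕ → V), c 0 = i ∧ c s = j ∧ ∀ l < s, 0 < p k (c (l + 1)) (c l))
    {z : ℕ → V → ℝ} (hz : ∀ k i, z (k + 1) i = ∑ j, p k i j * z k j)
    {k : ℕ} (h0 : ∀ i, 0 ≤ z k i) (hpos : ∃ i, 0 < z k i) (t : ℕ) :
    min (Fintype.card V) (t + 1) ≤ (Finset.univ.filter fun i => 0 < z (k + t) i).card := by
  induction t with
  | zero =>
    obtain ⟨i, hi⟩ := hpos
    exact (min_le_right _ _).trans (Finset.card_pos.2 ⟨i, by simpa using hi⟩)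
  | succ t ih =>
    have hnn := nonneg_of_nonneg_recursion hp hz h0 t
    have hsub : (Finset.univ.filter fun i => 0 < z (k + t) i) ⊆
        Finset.univ.filter fun i => 0 < z (k + (t + 1)) i := by
      intro i hi
      simp only [Finset.mem_filter, Finset.mem_univ, true_and] at hi ⊢
      exact pos_succ_of_pos_of_weight_pos hp hz hnn (hself _ i) hi
    by_cases hall : ∀ i, 0 < z (k + t) i
    · have hcard := Finset.card_le_card hsub
      rw [Finset.filter_true_of_mem fun i _ => hall i, Finset.card_univ] at hcard
      exact (min_le_left _ _).trans hcard
    · push Not at hall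
      obtain ⟨j, hj⟩ := hall
      have hV : 0 < Fintype.card V := Fintype.card_pos_iff.2 ⟨j⟩
      obtain ⟨i, hi⟩ : (Finset.univ.filter fun i => 0 < z (k + t) i).Nonempty :=
        Finset.card_pos.1 (by omega)
      simp only [Finset.mem_filter, Finset.mem_univ, true_and] at hi
      obtain ⟨s, c, rfl, rfl, hc⟩ := hconn (k + t) i j (by rintro rfl; exact hj.not_gt hi)
      obtain ⟨l, hl, hl0, hl1⟩ :=
        exists_step_of_holds_of_not_holds (P := fun l => 0 < z (k + t) (c l)) hi hj.not_gt
      have hlt := Finset.card_lt_card ((Finset.ssubset_iff_of_subset hsub).2 ⟨c (l + 1), by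
        exact Finset.mem_filter.2 ⟨Finset.mem_univ _,
          pos_succ_of_pos_of_weight_pos hp hz hnn (hc l hl) hl0⟩, by simpa using hl1⟩)
      omega

/-- Along strongly connected digraphs with self-loops, a nonzero nonnegative vector becomes
positive everywhere after `card V - 1` steps. -/
theorem pos_of_card_le {V : Type*} [Fintype V] {p : ℕ → V → V → ℝ}
    (hp : ∀ k i j, 0 ≤ p k i j) (hself : ∀ k i, 0 < p k i i)
    (hconn : ∀ (k : ℕ) (i j : V), i ≠ j →
      ∃ (s : ℕ) (c : ℕ → V), c 0 = i ∧ c s = j ∧ ∀ l < s, 0 < p k (c (l + 1)) (c l))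
    {z : ℕ → V → ℝ} (hz : ∀ k i, z (k + 1) i = ∑ j, p k i j * z k j)
    {k : ℕ} (h0 : ∀ i, 0 ≤ z k i) (hpos : ∃ i, 0 < z k i) {t : ℕ}
    (ht : Fintype.card V ≤ t + 1) (i : V) : 0 < z (k + t) i := by
  have h := min_card_le_card_support hp hself hconn hz h0 hpos t
  rw [min_eq_left ht] at h
  have huniv := Finset.eq_univ_of_card _ (le_antisymm (Finset.card_le_univ _) h)
  simpa using Finset.ext_iff.1 huniv i

theorem stmt_7 (n : ℕ) (hn : 1 ≤ n)
    (E : ℕ → Fin n → Fin n → Prop)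
    (hself : ∀ (k : ℕ) (i : Fin n), E k i i)
    (hconn : ∀ (k : ℕ) (i j : Fin n), i ≠ j →
      ∃ (s : ℕ) (c : ℕ → Fin n), c 0 = i ∧ c s = j ∧ ∀ l < s, E k (c (l + 1)) (c l))
    (p : ℕ → Fin n → Fin n → ℝ)
    (hp_nonneg : ∀ (k : ℕ) (i j : Fin n), 0 ≤ p k i j)
    (hp_pos : ∀ (k : ℕ) (i j : Fin n), 0 < p k i j ↔ E k i j)
    (hp_col : ∀ (k : ℕ) (j : Fin n), ∑ i, p k i j = 1)
    (x y : ℕ → Fin n → ℝ)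
    (hy0 : ∀ i : Fin n, y 0 i = 1)
    (hx : ∀ (k : ℕ) (i : Fin n), x (k + 1) i = ∑ j, p k i j * x k j)
    (hy : ∀ (k : ℕ) (i : Fin n), y (k + 1) i = ∑ j, p k i j * y k j)
    (M m : ℕ → ℝ)
    (hM : ∀ k : ℕ, IsGreatest (Set.range fun i => x k i / y k i) (M k))
    (hm : ∀ k : ℕ, IsLeast (Set.range fun i => x k i / y k i) (m k))
    (n' : ℕ) (hn' : n - 1 ≤ n')
    :
    ∀ k : ℕ, m k < M k →
      ∀ (k' : ℕ), k + n' ≤ k' → ∀ i : Fin n,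
        m k < x k' i / y k' i ∧ x k' i / y k' i < M k := by
  intro k hmM k' hk' i
  obtain ⟨t, rfl⟩ := Nat.exists_eq_add_of_le (le_of_add_le_left hk')
  have hself' : ∀ k i, 0 < p k i i := fun k i => (hp_pos k i i).2 (hself k i)
  have hconn' : ∀ (k : ℕ) (i j : Fin n), i ≠ j →
      ∃ (s : ℕ) (c : ℕ → Fin n), c 0 = i ∧ c s = j ∧ ∀ l < s, 0 < p k (c (l + 1)) (c l) := by
    simpa only [hp_pos] using hconn
  have hypos : ∀ k i, 0 < y k i := by
    intro k
    induction k with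
    | zero => simp [hy0]
    | succ k ih =>
      exact fun i =>
        pos_succ_of_pos_of_weight_pos hp_nonneg hy (fun j => (ih j).le) (hself' k i) (ih i)
  have ht : Fintype.card (Fin n) ≤ t + 1 := by
    rw [Fintype.card_fin]
    omega
  obtain ⟨⟨a, ha⟩, hub⟩ := hM k
  obtain ⟨⟨b, hb⟩, hlb⟩ := hm k
  have hle : ∀ j, x k j / y k j ≤ M k := fun j => hub ⟨j, rfl⟩
  have hge : ∀ j, m k ≤ x k j / y k j := fun j => hlb ⟨j, rfl⟩
  dsimp only at ha hb
  constructor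
  · have h := pos_of_card_le hp_nonneg hself' hconn' (z := fun l j => x l j - m k * y l j)
      (fun l j => by
        rw [hx, hy, Finset.mul_sum, ← Finset.sum_sub_distrib]
        exact Finset.sum_congr rfl fun _ _ => by ring)
      (k := k) (fun j => sub_nonneg.2 ((le_div_iff₀ (hypos k j)).1 (hge j)))
      ⟨a, sub_pos.2 ((lt_div_iff₀ (hypos k a)).1 (ha ▸ hmM))⟩ ht i
    exact (lt_div_iff₀ (hypos _ i)).2 (sub_pos.1 h)
  · have h := pos_of_card_le hp_nonneg hself' hconn' (z := fun l j => M k * y l j - x l j)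
      (fun l j => by
        rw [hx, hy, Finset.mul_sum, ← Finset.sum_sub_distrib]
        exact Finset.sum_congr rfl fun _ _ => by ring)
      (k := k) (fun j => sub_nonneg.2 ((div_le_iff₀ (hypos k j)).1 (hle j)))
      ⟨b, sub_pos.2 ((div_lt_iff₀ (hypos k b)).1 (hb ▸ hmM))⟩ ht i
    exact (div_lt_iff₀ (hypos _ i)).2 (sub_pos.1 h)
end

section
/- Under the stated hypotheses, for all time instants k' ≥ k and for every node i ∈ V, the ratio of states remains bounded by the past extrema: m(k) ≤ x_i(k')/y_i(k') ≤ M(k). -/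
open Filter Topology

/-- A nonnegative linear map with positive diagonal preserves entrywise positivity. -/
theorem sum_mul_pos_of_diag_pos {ι : Type*} [Fintype ι] {p : ι → ι → ℝ} {v : ι → ℝ}
    (hp : ∀ i j, 0 ≤ p i j) (hdiag : ∀ i, 0 < p i i) (hv : ∀ i, 0 < v i) (i : ι) :
    0 < ∑ j, p i j * v j :=
  Finset.sum_pos' (fun j _ => mul_nonneg (hp i j) (hv j).le)
    ⟨i, Finset.mem_univ i, mul_pos (hdiag i) (hv i)⟩

/-- Nonnegative combinations preserve proportional upper bounds. -/
theorem sum_mul_le_mul_sum_mul {ι : Type*} [Fintype ι] {w u v : ι → ℝ} {c : ℝ}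
    (hw : ∀ j, 0 ≤ w j) (h : ∀ j, u j ≤ c * v j) :
    ∑ j, w j * u j ≤ c * ∑ j, w j * v j := by
  rw [Finset.mul_sum]
  refine Finset.sum_le_sum fun j _ => ?_
  rw [mul_left_comm]
  exact mul_le_mul_of_nonneg_left (h j) (hw j)

/-- Nonnegative combinations preserve proportional lower bounds. -/
theorem mul_sum_mul_le_sum_mul {ι : Type*} [Fintype ι] {w u v : ι → ℝ} {c : ℝ}
    (hw : ∀ j, 0 ≤ w j) (h : ∀ j, c * v j ≤ u j) :
    c * ∑ j, w j * v j ≤ ∑ j, w j * u j := by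
  rw [Finset.mul_sum]
  refine Finset.sum_le_sum fun j _ => ?_
  rw [mul_left_comm]
  exact mul_le_mul_of_nonneg_left (h j) (hw j)

theorem stmt_12 (n : ℕ) (hn : 1 ≤ n)
    (E : ℕ → Fin n → Fin n → Prop)
    (hself : ∀ (k : ℕ) (i : Fin n), E k i i)
    (p : ℕ → Fin n → Fin n → ℝ)
    (hp_nonneg : ∀ (k : ℕ) (i j : Fin n), 0 ≤ p k i j)
    (hp_pos : ∀ (k : ℕ) (i j : Fin n), 0 < p k i j ↔ E k i j)
    (hp_col : ∀ (k : ℕ) (j : Fin n), ∑ i, p k i j = 1)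
    (x y : ℕ → Fin n → ℝ)
    (hy0 : ∀ i : Fin n, y 0 i = 1)
    (hx : ∀ (k : ℕ) (i : Fin n), x (k + 1) i = ∑ j, p k i j * x k j)
    (hy : ∀ (k : ℕ) (i : Fin n), y (k + 1) i = ∑ j, p k i j * y k j)
    (M m : ℕ → ℝ)
    (hM : ∀ k : ℕ, IsGreatest (Set.range fun i => x k i / y k i) (M k))
    (hm : ∀ k : ℕ, IsLeast (Set.range fun i => x k i / y k i) (m k))
    :
    ∀ (k k' : ℕ), k ≤ k' → ∀ i : Fin n,
      m k ≤ x k' i / y k' i ∧ x k' i / y k' i ≤ M k := by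
  have y_pos : ∀ k i, 0 < y k i := by
    intro k
    induction k with
    | zero => simp [hy0]
    | succ k ih =>
      intro i
      rw [hy]
      exact sum_mul_pos_of_diag_pos (hp_nonneg k) (fun i => (hp_pos k i i).2 (hself k i)) ih i
  intro k k' hk
  suffices h : ∀ i, m k * y k' i ≤ x k' i ∧ x k' i ≤ M k * y k' i from fun i =>
    ⟨(le_div_iff₀ (y_pos k' i)).2 (h i).1, (div_le_iff₀ (y_pos k' i)).2 (h i).2⟩
  induction k', hk using Nat.le_induction with
  | base =>
    exact fun i => ⟨(le_div_iff₀ (y_pos k i)).1 ((hm k).2 ⟨i, rfl⟩),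
      (div_le_iff₀ (y_pos k i)).1 ((hM k).2 ⟨i, rfl⟩)⟩
  | succ l _ ih =>
    intro i
    rw [hx, hy]
    exact ⟨mul_sum_mul_le_sum_mul (hp_nonneg l i) fun j => (ih j).1,
      sum_mul_le_mul_sum_mul (hp_nonneg l i) fun j => (ih j).2⟩
end

section
/- Under the stated hypotheses, strict bounds are preserved: if at some time k' ≥ k a node i satisfies x_i(k')/y_i(k') < M(k), then x_i(k'')/y_i(k'') < M(k) for all k'' ≥ k'; and if a node j satisfies x_j(k')/y_j(k') > m(k), then x_j(k'')/y_j(k'') > m(k) for all k'' ≥ k'. -/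
open Filter Topology

section NonnegIteration

variable {ι : Type*} [Fintype ι] {p : ℕ → ι → ι → ℝ} {z : ℕ → ι → ℝ}

/-- A linear iteration with nonnegative weights preserves nonnegativity. -/
theorem nonneg_of_nonneg_weights (hp : ∀ k i j, 0 ≤ p k i j)
    (hz : ∀ k i, z (k + 1) i = ∑ j, p k i j * z k j) {k k' : ℕ} (hk : k ≤ k')
    (h : ∀ i, 0 ≤ z k i) : ∀ i, 0 ≤ z k' i := by
  induction k', hk using Nat.le_induction with
  | base => exact h
  | succ l _ ih =>
    intro i
    rw [hz]
    exact Finset.sum_nonneg fun j _ => mul_nonneg (hp l i j) (ih j)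

/-- In a linear iteration with nonnegative weights and positive self-weights, a positive
coordinate of a nonnegative state stays positive. -/
theorem pos_of_pos_self_weights (hp : ∀ k i j, 0 ≤ p k i j) (hpp : ∀ k i, 0 < p k i i)
    (hz : ∀ k i, z (k + 1) i = ∑ j, p k i j * z k j) {k k' : ℕ} (hk : k ≤ k')
    (h : ∀ i, 0 ≤ z k i) {i : ι} (hi : 0 < z k i) : 0 < z k' i := by
  induction k', hk using Nat.le_induction with
  | base => exact hi
  | succ l hl ih =>
    rw [hz]
    exact Finset.sum_pos'
      (fun j _ => mul_nonneg (hp l i j) (nonneg_of_nonneg_weights hp hz hl h j))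
      ⟨i, Finset.mem_univ i, mul_pos (hpp l i) ih⟩

/-- An upper bound on all ratios at time `k` that is strict for node `i` at a later time `k'`
remains strict for `i` from then on. -/
theorem div_lt_of_div_le_of_div_lt {x y : ℕ → ι → ℝ} (hp : ∀ k i j, 0 ≤ p k i j)
    (hpp : ∀ k i, 0 < p k i i)
    (hx : ∀ k i, x (k + 1) i = ∑ j, p k i j * x k j)
    (hy : ∀ k i, y (k + 1) i = ∑ j, p k i j * y k j) (hypos : ∀ k i, 0 < y k i)
    {c : ℝ} {k k' k'' : ℕ} (hk : k ≤ k') (hk' : k' ≤ k'') (h : ∀ i, x k i / y k i ≤ c)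
    {i : ι} (hi : x k' i / y k' i < c) : x k'' i / y k'' i < c := by
  have hz : ∀ l i, c * y (l + 1) i - x (l + 1) i = ∑ j, p l i j * (c * y l j - x l j) := by
    intro l i
    rw [hx, hy, Finset.mul_sum, ← Finset.sum_sub_distrib]
    exact Finset.sum_congr rfl fun j _ => by ring
  have hnonneg := nonneg_of_nonneg_weights (z := fun l i => c * y l i - x l i) hp hz hk
    fun j => sub_nonneg.2 ((div_le_iff₀ (hypos k j)).1 (h j))
  have hpos := pos_of_pos_self_weights (z := fun l i => c * y l i - x l i) hp hpp hz hk' hnonneg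
    (sub_pos.2 ((div_lt_iff₀ (hypos k' i)).1 hi))
  exact (div_lt_iff₀ (hypos k'' i)).2 (sub_pos.1 hpos)

end NonnegIteration

theorem stmt_13 (n : ℕ) (hn : 1 ≤ n)
    (E : ℕ → Fin n → Fin n → Prop)
    (hself : ∀ (k : ℕ) (i : Fin n), E k i i)
    (p : ℕ → Fin n → Fin n → ℝ)
    (hp_nonneg : ∀ (k : ℕ) (i j : Fin n), 0 ≤ p k i j)
    (hp_pos : ∀ (k : ℕ) (i j : Fin n), 0 < p k i j ↔ E k i j)
    (hp_col : ∀ (k : ℕ) (j : Fin n), ∑ i, p k i j = 1)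
    (x y : ℕ → Fin n → ℝ)
    (hy0 : ∀ i : Fin n, y 0 i = 1)
    (hx : ∀ (k : ℕ) (i : Fin n), x (k + 1) i = ∑ j, p k i j * x k j)
    (hy : ∀ (k : ℕ) (i : Fin n), y (k + 1) i = ∑ j, p k i j * y k j)
    (M m : ℕ → ℝ)
    (hM : ∀ k : ℕ, IsGreatest (Set.range fun i => x k i / y k i) (M k))
    (hm : ∀ k : ℕ, IsLeast (Set.range fun i => x k i / y k i) (m k))
    :
    ∀ (k k' : ℕ), k ≤ k' →
      (∀ i : Fin n, x k' i / y k' i < M k →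
        ∀ k'' : ℕ, k' ≤ k'' → x k'' i / y k'' i < M k) ∧
      (∀ j : Fin n, x k' j / y k' j > m k →
        ∀ k'' : ℕ, k' ≤ k'' → x k'' j / y k'' j > m k) := by
  have hpp : ∀ k i, 0 < p k i i := fun k i => (hp_pos k i i).2 (hself k i)
  have hypos : ∀ k i, 0 < y k i := fun k i =>
    pos_of_pos_self_weights hp_nonneg hpp hy (Nat.zero_le k) (by simp [hy0]) (by simp [hy0])
  intro k k' hk
  refine ⟨fun i hi k'' hk' => ?_, fun j hj k'' hk' => ?_⟩
  · exact div_lt_of_div_le_of_div_lt hp_nonneg hpp hx hy hypos hk hk'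
      (fun j => (hM k).2 ⟨j, rfl⟩) hi
  · have hlt := div_lt_of_div_le_of_div_lt (x := fun l i => -x l i) (c := -m k) (i := j)
      hp_nonneg hpp (fun l i => by simp [hx]) hy hypos hk hk'
      (fun i => by
        rw [neg_div]
        exact neg_le_neg ((hm k).2 ⟨i, rfl⟩))
      (by
        rw [neg_div]
        exact neg_lt_neg hj)
    rw [neg_div] at hlt
    exact neg_lt_neg_iff.1 hlt
end

section
/- (One-step strict propagation along an edge.) Under the stated hypotheses, let k be a time and c ∈ ℝ be such that x_u(k)/y_u(k) ≤ c for all u ∈ V. If (i,j) ∈ E(k) and x_j(k)/y_j(k) < c, then x_i(k+1)/y_i(k+1) < c. Symmetrically, if c' ∈ ℝ satisfies x_u(k)/y_u(k) ≥ c' for all u ∈ V, (i,j) ∈ E(k) and x_j(k)/y_j(k) > c', then x_i(k+1)/y_i(k+1) > c'. -/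
open Filter Topology

theorem sum_mul_div_sum_mul_lt {ι : Type*} [Fintype ι] {w a b : ι → ℝ} {c : ℝ} {j : ι}
    (hw : ∀ u, 0 ≤ w u) (hb : ∀ u, 0 < b u) (hwj : 0 < w j)
    (hle : ∀ u, a u / b u ≤ c) (hlt : a j / b j < c) :
    (∑ u, w u * a u) / (∑ u, w u * b u) < c := by
  have hpos : 0 < ∑ u, w u * b u :=
    Finset.sum_pos' (fun u _ => mul_nonneg (hw u) (hb u).le)
      ⟨j, Finset.mem_univ j, mul_pos hwj (hb j)⟩
  rw [div_lt_iff₀ hpos, Finset.mul_sum]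
  refine Finset.sum_lt_sum (fun u _ => ?_) ⟨j, Finset.mem_univ j, ?_⟩
  · rw [mul_left_comm]
    exact mul_le_mul_of_nonneg_left ((div_le_iff₀ (hb u)).1 (hle u)) (hw u)
  · rw [mul_left_comm]
    exact mul_lt_mul_of_pos_left ((div_lt_iff₀ (hb j)).1 hlt) hwj

theorem lt_sum_mul_div_sum_mul {ι : Type*} [Fintype ι] {w a b : ι → ℝ} {c : ℝ} {j : ι}
    (hw : ∀ u, 0 ≤ w u) (hb : ∀ u, 0 < b u) (hwj : 0 < w j)
    (hle : ∀ u, c ≤ a u / b u) (hlt : c < a j / b j) :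
    c < (∑ u, w u * a u) / (∑ u, w u * b u) := by
  have h := sum_mul_div_sum_mul_lt (a := fun u => -a u) (c := -c) hw hb hwj
    (fun u => by rw [neg_div]; exact neg_le_neg (hle u))
    (by rw [neg_div]; exact neg_lt_neg hlt)
  simpa only [mul_neg, Finset.sum_neg_distrib, neg_div, neg_lt_neg_iff] using h

theorem stmt_14 (n : ℕ) (hn : 1 ≤ n)
    (E : ℕ → Fin n → Fin n → Prop)
    (hself : ∀ (k : ℕ) (i : Fin n), E k i i)
    (p : ℕ → Fin n → Fin n → ℝ)
    (hp_nonneg : ∀ (k : ℕ) (i j : Fin n), 0 ≤ p k i j)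
    (hp_pos : ∀ (k : ℕ) (i j : Fin n), 0 < p k i j ↔ E k i j)
    (hp_col : ∀ (k : ℕ) (j : Fin n), ∑ i, p k i j = 1)
    (x y : ℕ → Fin n → ℝ)
    (hy0 : ∀ i : Fin n, y 0 i = 1)
    (hx : ∀ (k : ℕ) (i : Fin n), x (k + 1) i = ∑ j, p k i j * x k j)
    (hy : ∀ (k : ℕ) (i : Fin n), y (k + 1) i = ∑ j, p k i j * y k j)
    :
    ∀ (k : ℕ) (i j : Fin n), E k i j →
      (∀ c : ℝ, (∀ u : Fin n, x k u / y k u ≤ c) → x k j / y k j < c →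
        x (k + 1) i / y (k + 1) i < c) ∧
      (∀ c' : ℝ, (∀ u : Fin n, c' ≤ x k u / y k u) → c' < x k j / y k j →
        c' < x (k + 1) i / y (k + 1) i) := by
  have hypos : ∀ (k : ℕ) (i : Fin n), 0 < y k i := by
    intro k
    induction k with
    | zero => intro i; rw [hy0]; exact one_pos
    | succ k ih =>
      intro i
      rw [hy]
      exact Finset.sum_pos' (fun u _ => mul_nonneg (hp_nonneg k i u) (ih u).le)
        ⟨i, Finset.mem_univ i, mul_pos ((hp_pos k i i).2 (hself k i)) (ih i)⟩
  intro k i j hij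
  rw [hx, hy]
  exact ⟨fun c => sum_mul_div_sum_mul_lt (hp_nonneg k i) (hypos k) ((hp_pos k i j).2 hij),
    fun c' => lt_sum_mul_div_sum_mul (hp_nonneg k i) (hypos k) ((hp_pos k i j).2 hij)⟩
end
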